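/- Fix integers n ≥ 2 and 1 ≤ k ≤ n−1, and let I be a root set of type (k,n) such that S_{(b^a)}(I) ≠ 0 for every rectangular partition with 1 ≤ a ≤ k rows and 1 ≤ b ≤ n−k columns (here S denotes k-variable Schur polynomials, with S_∅ = 1). Define the point x* ∈ (ℂ^×)^{k(n−k)} with coordinates x*_{i,j} = S_{(j^{k+1−i})}(I) / S_{((j−1)^{k−i})}(I) for 1 ≤ i ≤ k, 1 ≤ j ≤ n−k. Then x* is a critical point of the Laurent polynomial W(x) = Σ_{i=1}^{k−1} Σ_{j=1}^{n−k} x_{i,j}/x_{i+1,j} + Σ_{i=1}^{k} Σ_{j=1}^{n−k−1} x_{i,j+1}/x_{i,j} + 1/x_{1,n−k} + x_{k,1} (i.e., all partial derivatives of W vanish at x*), and the critical value is W(x*) = n·Σ_{ζ∈I} ζ. -/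

import Mathlib

noncomputable section

/-- Cells of the Young diagram of `lam` (at most `m` rows). -/
def youngCells (m : ℕ) (lam : ℕ → ℕ) : Finset (ℕ × ℕ) :=
  (Finset.range m).biUnion fun r => (Finset.range (lam r)).image fun c => (r, c)

/-- A filling of the diagram with entries in `{1,…,m}` is a semistandard Young tableau if
rows are weakly increasing and columns are strictly increasing. -/
def IsSSYT {m : ℕ} {lam : ℕ → ℕ} (T : {p // p ∈ youngCells m lam} → Fin m) : Prop :=
  (∀ p q : {p // p ∈ youngCells m lam},
      (p : ℕ × ℕ).1 = (q : ℕ × ℕ).1 → (q : ℕ × ℕ).2 = (p : ℕ × ℕ).2 + 1 → T p ≤ T q) ∧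
  (∀ p q : {p // p ∈ youngCells m lam},
      (p : ℕ × ℕ).2 = (q : ℕ × ℕ).2 → (q : ℕ × ℕ).1 = (p : ℕ × ℕ).1 + 1 → T p < T q)

open Classical in
/-- The finite set of semistandard Young tableaux of shape `lam` with entries in `{1,…,m}`. -/
def ssytFinset (m : ℕ) (lam : ℕ → ℕ) : Finset ({p // p ∈ youngCells m lam} → Fin m) :=
  Finset.univ.filter IsSSYT

/-- The Schur polynomial of the partition `lam`, evaluated at `x 0, …, x (m-1)`:
the sum over semistandard Young tableaux of the corresponding monomials. -/
def schur (m : ℕ) (lam : ℕ → ℕ) (x : Fin m → ℂ) : ℂ :=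
  ∑ T ∈ ssytFinset m lam, ∏ p, x (T p)

/-- Evaluation of the Schur polynomial (in `I.card` variables) at a finite set of
complex numbers; well defined since Schur polynomials are symmetric. -/
def schurSet (lam : ℕ → ℕ) (I : Finset ℂ) : ℂ :=
  schur I.card lam fun i => (I.equivFin.symm i : ℂ)

/-- A root set of type `(k,n)`: a set of `k` distinct complex numbers
each satisfying `ζ^n = (-1)^(k+1)`. -/
def IsRootSet (k n : ℕ) (I : Finset ℂ) : Prop :=
  I.card = k ∧ ∀ z ∈ I, z ^ n = (-1 : ℂ) ^ (k + 1)




/-- The rectangular partition `(partSize^numParts)`: `numParts` parts equal to `partSize`. -/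
def rectPart (numParts partSize : ℕ) : ℕ → ℕ := fun r => if r < numParts then partSize else 0

/-- The Maslov 2 disk potential of the monotone Gelfand–Cetlin torus in `Gr(k,n)`
(`m = n−k`), as a function of the holonomy coordinates `x (i,j)`, `1 ≤ i ≤ k`,
`1 ≤ j ≤ m`. -/
def gcPotential (k m : ℕ) (x : ℕ × ℕ → ℂ) : ℂ :=
  (∑ i ∈ Finset.Icc 1 (k - 1), ∑ j ∈ Finset.Icc 1 m, x (i, j) / x (i + 1, j))
    + (∑ i ∈ Finset.Icc 1 k, ∑ j ∈ Finset.Icc 1 (m - 1), x (i, j + 1) / x (i, j))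
    + 1 / x (1, m) + x (k, 1)

/-- The point `x*` with coordinates `x*_{i,j} = S_{(j^{k+1−i})}(I) / S_{((j−1)^{k−i})}(I)`. -/
def xstar (k : ℕ) (I : Finset ℂ) : ℕ × ℕ → ℂ := fun q =>
  schurSet (rectPart (k + 1 - q.1) q.2) I / schurSet (rectPart (k - q.1) (q.2 - 1)) I


theorem plucker3 {ι : Type*} [Fintype ι] [DecidableEq ι] (w : Matrix ι ι ℂ) (i j : ι) (hij : i ≠ j)
    (p q r s : ι → ℂ) :
    ((w.updateRow i p).updateRow j q).det * ((w.updateRow i r).updateRow j s).det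
    - ((w.updateRow i p).updateRow j r).det * ((w.updateRow i q).updateRow j s).det
    + ((w.updateRow i p).updateRow j s).det * ((w.updateRow i q).updateRow j r).det = 0 := by
  set f : (ι → ℂ) → (ι → ℂ) → ℂ := fun u v => ((w.updateRow i u).updateRow j v).det with hf
  have halt : ∀ u, f u u = 0 := by
    intro u
    apply Matrix.det_zero_of_row_eq hij
    simp [Matrix.updateRow_ne hij]
  have hlin2 : ∀ (u : ι → ℂ) (c : ι → ℂ) (g : ι → ι → ℂ), f u (∑ l, c l • g l) = ∑ l, c l * f u (g l) := by
    intro u c g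
    simp only [hf]
    let φ : (ι → ℂ) →ₗ[ℂ] ℂ := (Matrix.detRowAlternating (n := ι) (R := ℂ)).toMultilinearMap.toLinearMap (w.updateRow i u) j
    have hφ : ∀ v, ((w.updateRow i u).updateRow j v).det = φ v := fun v => rfl
    simp [hφ, map_sum]
  have hsw : ∀ u v, f v u = - f u v := by
    intro u v
    have h := halt (u + v)
    have e1 : ∀ a, f a (u + v) = f a u + f a v := fun a => Matrix.det_updateRow_add _ _ _ _
    have e2 : ∀ a, f (u + v) a = f u a + f v a := by
      intro a
      simp only [hf]
      rw [Matrix.updateRow_comm _ hij, Matrix.updateRow_comm _ hij, Matrix.updateRow_comm _ hij, Matrix.det_updateRow_add]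
    rw [e1, e2, e2, halt, halt] at h
    linear_combination h
  change f p q * f r s - f p r * f q s + f p s * f q r = 0
  by_cases hz : ∀ u v, f u v = 0
  · simp [hz]
  push Not at hz
  obtain ⟨u, v, huv⟩ := hz
  set M := (w.updateRow i u).updateRow j v with hM
  have hexp : ∀ y : ι → ℂ, ∃ α β : ℂ, ∀ z, f z y = α * f z u + β * f z v := by
    intro y
    have hy : y = ∑ l, ((M.det)⁻¹ * (Matrix.cramer M.transpose y) l) • M l := by
      have h := Matrix.mulVec_cramer M.transpose y
      rw [Matrix.det_transpose] at h
      have hd : M.det ≠ 0 := huv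
      ext t
      have h2 := congrFun h t
      simp only [Matrix.mulVec, dotProduct, Matrix.transpose_apply, Pi.smul_apply, smul_eq_mul] at h2
      simp only [Finset.sum_apply, Pi.smul_apply, smul_eq_mul]
      rw [← mul_right_inj' hd, ← h2, Finset.mul_sum]
      refine Finset.sum_congr rfl fun l _ => ?_
      field_simp
    set c : ι → ℂ := fun l => (M.det)⁻¹ * (Matrix.cramer M.transpose y) l
    refine ⟨c i, c j, fun z => ?_⟩
    conv_lhs => rw [hy]
    refine (hlin2 z c M).trans ?_
    have hvan : ∀ l, l ≠ i → l ≠ j → f z (M l) = 0 := by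
      intro l hi hj
      apply Matrix.det_zero_of_row_eq (i := l) (j := j) hj
      rw [Matrix.updateRow_self, Matrix.updateRow_ne hj, Matrix.updateRow_ne hi, hM, Matrix.updateRow_ne hj, Matrix.updateRow_ne hi]
    have hMi : M i = u := by rw [hM, Matrix.updateRow_ne hij, Matrix.updateRow_self]
    have hMj : M j = v := by rw [hM, Matrix.updateRow_self]
    rw [← Finset.sum_subset (Finset.subset_univ {i, j}), Finset.sum_pair hij, hMi, hMj]
    intro l _ hl
    simp only [Finset.mem_insert, Finset.mem_singleton, not_or] at hl
    rw [hvan l hl.1 hl.2, mul_zero]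
  obtain ⟨a1, b1, hp⟩ := hexp p
  obtain ⟨a2, b2, hq⟩ := hexp q
  obtain ⟨a3, b3, hr⟩ := hexp r
  obtain ⟨a4, b4, hs⟩ := hexp s
  have key : ∀ y z a b a' b', (∀ t, f t y = a * f t u + b * f t v) → (∀ t, f t z = a' * f t u + b' * f t v) →
      f y z = (a * b' - b * a') * f u v := by
    intro y z a b a' b' h1 h2
    rw [h2, hsw u y, hsw v y, h1, h1, halt, halt, hsw u v]
    ring
  rw [key p q _ _ _ _ hp hq, key r s _ _ _ _ hr hs, key p r _ _ _ _ hp hr, key q s _ _ _ _ hq hs,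
    key p s _ _ _ _ hp hs, key q r _ _ _ _ hq hr]
  ring

/-- alternant -/
def altD {m : ℕ} (x : Fin m → ℂ) (e : Fin m → ℕ) : ℂ :=
  (Matrix.of fun (j i : Fin m) => x i ^ e j).det

theorem altD_perm {m : ℕ} (x : Fin m → ℂ) (e : Fin m → ℕ) (σ : Equiv.Perm (Fin m)) :
    altD x (fun j => e (σ j)) = ((Equiv.Perm.sign σ : ℤ) : ℂ) * altD x e := by
  unfold altD
  rw [← Matrix.det_permute]
  rfl

theorem altD_shift {m : ℕ} (x : Fin m → ℂ) (e : Fin m → ℕ) (b : ℕ) :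
    altD x (fun j => e j + b) = (∏ i, x i) ^ b * altD x e := by
  unfold altD
  rw [← Finset.prod_pow, ← Matrix.det_mul_row]
  congr 1
  ext j i
  simp [pow_add, mul_comm]

def cyc {k : ℕ} (l h : Fin k) (hlh : l ≤ h) : Equiv.Perm (Fin k) where
  toFun j := ⟨if (j : ℕ) = l then (h : ℕ) else if (l : ℕ) < j ∧ (j : ℕ) ≤ h then (j : ℕ) - 1 else j, by
    have := j.2; have := h.2; split_ifs <;> omega⟩
  invFun j := ⟨if (j : ℕ) = h then (l : ℕ) else if (l : ℕ) ≤ j ∧ (j : ℕ) < h then (j : ℕ) + 1 else j, by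
    have := j.2; have := h.2; have := l.2; split_ifs <;> omega⟩
  left_inv j := by
    rw [Fin.le_def] at hlh
    apply Fin.ext
    simp only
    split_ifs <;> omega
  right_inv j := by
    rw [Fin.le_def] at hlh
    apply Fin.ext
    simp only
    split_ifs <;> omega

theorem cyc_val {k : ℕ} (l h : Fin k) (hlh : l ≤ h) (j : Fin k) :
    ((cyc l h hlh j : Fin k) : ℕ) = if (j : ℕ) = l then (h : ℕ) else if (l : ℕ) < j ∧ (j : ℕ) ≤ h then (j : ℕ) - 1 else j := rfl

/-- exponents of rectangle, increasing order -/
def rexp (k a b : ℕ) : Fin k → ℕ := fun j => if (j : ℕ) < k - a then (j : ℕ) else j + b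

theorem altD_update2 {k : ℕ} (x : Fin k → ℂ) (e : Fin k → ℕ) (i j : Fin k) (p q : ℕ) :
    (((Matrix.of fun (j i : Fin k) => x i ^ e j).updateRow i (fun t => x t ^ p)).updateRow j (fun t => x t ^ q)).det
      = altD x (fun t => if t = j then q else if t = i then p else e t) := by
  unfold altD
  congr 1
  ext s t
  simp only [Matrix.updateRow_apply, Matrix.of_apply]
  split_ifs <;> rfl

theorem dodgson {k : ℕ} (x : Fin k → ℂ) (hx : ∏ i, x i ≠ 0) (a b : ℕ) (ha : 1 ≤ a) (hak : a < k) (hb : 1 ≤ b) :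
    altD x (rexp k a b) ^ 2 = altD x (rexp k (a + 1) b) * altD x (rexp k (a - 1) b)
      + altD x (rexp k a (b + 1)) * altD x (rexp k a (b - 1)) := by
  let i0 : Fin k := ⟨0, by omega⟩
  let j0 : Fin k := ⟨k - a, by omega⟩
  let i1 : Fin k := ⟨k - a - 1, by omega⟩
  let j1 : Fin k := ⟨k - 1, by omega⟩
  let σ := cyc i0 i1 (by simp only [i0, i1, Fin.le_def]; omega)
  let τ := cyc j0 j1 (by simp only [j0, j1, Fin.le_def]; omega)
  have hij : i0 ≠ j0 := by simp only [i0, j0, ne_eq, Fin.ext_iff]; omega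
  have P := plucker3 (Matrix.of fun (j i : Fin k) => x i ^ rexp k a b j) i0 j0 hij
    (fun t => x t ^ 0) (fun t => x t ^ (k - a)) (fun t => x t ^ (k - a + b)) (fun t => x t ^ (k + b))
  simp only [altD_update2] at P
  set s1 := ((Equiv.Perm.sign σ : ℤ) : ℂ) with hs1
  set s2 := ((Equiv.Perm.sign τ : ℤ) : ℂ) with hs2
  have n1 : s1 ≠ 0 := by simp [hs1]
  have n2 : s2 ≠ 0 := by simp [hs2]
  have h1 : altD x (fun t => if t = j0 then k - a else if t = i0 then 0 else rexp k a b t) = altD x (rexp k (a - 1) b) := by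
    congr 1; ext t
    have := t.2
    simp only [rexp, i0, j0, Fin.ext_iff]
    split_ifs <;> omega
  have h2 : altD x (fun t => if t = j0 then k - a + b else if t = i0 then 0 else rexp k a b t) = altD x (rexp k a b) := by
    congr 1; ext t
    have := t.2
    simp only [rexp, i0, j0, Fin.ext_iff]
    split_ifs <;> omega
  have h3 : altD x (fun t => if t = j0 then k + b else if t = i0 then 0 else rexp k a b t) = s2 * altD x (rexp k a (b + 1)) := by
    rw [hs2, ← altD_perm]
    congr 1; ext t
    have := t.2
    simp only [rexp, τ, cyc_val]
    simp only [i0, j0, j1, Fin.ext_iff]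
    split_ifs <;> omega
  have h4 : altD x (fun t => if t = j0 then k - a + b else if t = i0 then k - a else rexp k a b t)
      = s1 * ((∏ i, x i) ^ 1 * altD x (rexp k a (b - 1))) := by
    rw [hs1, ← altD_shift, ← altD_perm]
    congr 1; ext t
    have := t.2
    simp only [rexp, σ, cyc_val]
    simp only [i0, i1, j0, Fin.ext_iff]
    split_ifs <;> omega
  have h5 : altD x (fun t => if t = j0 then k + b else if t = i0 then k - a else rexp k a b t)
      = s2 * (s1 * ((∏ i, x i) ^ 1 * altD x (rexp k a b))) := by
    rw [hs1, hs2, ← altD_shift, ← altD_perm, ← altD_perm x (fun j => rexp k a b (σ j) + 1) τ]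
    congr 1; ext t
    have := t.2
    simp only [rexp, σ, τ, cyc_val]
    simp only [i0, i1, j0, j1, Fin.ext_iff]
    split_ifs <;> omega
  have h6 : altD x (fun t => if t = j0 then k + b else if t = i0 then k - a + b else rexp k a b t)
      = s2 * (s1 * ((∏ i, x i) ^ 1 * altD x (rexp k (a + 1) b))) := by
    rw [hs1, hs2, ← altD_shift, ← altD_perm, ← altD_perm x (fun j => rexp k (a + 1) b (σ j) + 1) τ]
    congr 1; ext t
    have := t.2
    simp only [rexp, σ, τ, cyc_val]
    simp only [i0, i1, j0, j1, Fin.ext_iff]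
    split_ifs <;> omega
  rw [h1, h2, h3, h4, h5, h6] at P
  have hne : s1 * s2 * ∏ i, x i ≠ 0 := by positivity
  apply mul_left_cancel₀ hne
  linear_combination -P

theorem altD_full {k : ℕ} (x : Fin k → ℂ) (b : ℕ) :
    altD x (rexp k k b) = (∏ i, x i) ^ b * altD x (fun j => (j : ℕ)) := by
  rw [← altD_shift]
  congr 1; ext t; simp [rexp]

theorem altD_vanish {k n : ℕ} (c : ℂ) (x : Fin k → ℂ) (hx : ∀ i, x i ^ n = c) (hkn : k < n) (a : ℕ) (ha : 1 ≤ a) (hak : a < k) :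
    altD x (rexp k a (n - k + 1)) = 0 := by
  have h1 : altD x (rexp k a (n - k + 1)) =
     (((Matrix.of fun (j i : Fin k) => x i ^ rexp k a (n - k + 1) j).updateRow ⟨0, by omega⟩ (fun t => x t ^ 0)).updateRow ⟨k - 1, by omega⟩ (fun t => x t ^ n)).det := by
    rw [altD_update2]
    congr 1; ext t
    have := t.2
    simp only [rexp, Fin.ext_iff]
    split_ifs <;> omega
  rw [h1]
  have : (fun t => x t ^ n) = c • (fun t : Fin k => x t ^ 0) := by
    ext t; simp [hx]
  rw [this, Matrix.det_updateRow_smul]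
  have hne : (⟨0, by omega⟩ : Fin k) ≠ ⟨k - 1, by omega⟩ := by
    simp only [ne_eq, Fin.ext_iff]; omega
  rw [Matrix.det_zero_of_row_eq hne, mul_zero]
  simp [Matrix.updateRow_ne hne]

theorem altD_rot {k n : ℕ} (hk : 1 ≤ k) (x : Fin k → ℂ) (hx : ∀ i, x i ^ n = (-1) ^ (k + 1)) (hkn : k < n) :
    altD x (rexp k k (n - k + 1)) = altD x (rexp k (k - 1) (n - k)) := by
  obtain ⟨k, rfl⟩ : ∃ k', k = k' + 1 := ⟨k - 1, by omega⟩
  set e := rexp (k + 1) k (n - (k + 1)) with he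
  have h1 := altD_perm x (rexp (k + 1) (k + 1) (n - (k + 1) + 1)) (finRotate (k + 1))⁻¹
  have h2 : altD x (fun j => rexp (k + 1) (k + 1) (n - (k + 1) + 1) ((finRotate (k + 1))⁻¹ j))
     = (-1) ^ (k + 1 + 1) * altD x e := by
    have : altD x (fun j => rexp (k + 1) (k + 1) (n - (k + 1) + 1) ((finRotate (k + 1))⁻¹ j)) =
      ((Matrix.of fun (j i : Fin (k+1)) => x i ^ e j).updateRow 0 ((-1 : ℂ) ^ (k + 1 + 1) • fun t => x t ^ 0)).det := by
      unfold altD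
      congr 1
      ext s t
      simp only [Matrix.updateRow_apply, Matrix.of_apply]
      have hs : ∃ u, s = finRotate (k + 1) u := ⟨(finRotate (k+1)).symm s, by simp⟩
      obtain ⟨u, rfl⟩ := hs
      have hinv : (finRotate (k + 1))⁻¹ (finRotate (k + 1) u) = u := by simp
      rw [hinv]
      split_ifs with h
      · have hu : (u : ℕ) = k := by
          by_contra hc
          have := coe_finRotate_of_ne_last (i := u) (by intro h'; apply hc; rw [h']; rfl)
          rw [h] at this
          simp at this
        simp only [Pi.smul_apply, smul_eq_mul, pow_zero, mul_one, ← hx t]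
        congr 1
        simp only [rexp]
        split_ifs <;> omega
      · have hu : u ≠ Fin.last k := by
          rintro rfl; apply h; simp
        have := coe_finRotate_of_ne_last hu
        have := u.2
        congr 1
        simp only [he, rexp]
        split_ifs <;> omega
    rw [this, Matrix.det_updateRow_smul]
    congr 1
    unfold altD
    congr 1
    ext s t
    simp only [Matrix.updateRow_apply, Matrix.of_apply]
    split_ifs with h
    · simp [h, he, rexp]
    · rfl
  rw [h2, Equiv.Perm.sign_inv, sign_finRotate, Nat.add_sub_cancel] at h1
  have : (((-1 : ℤˣ) ^ k : ℤˣ) : ℤ) = (-1) ^ k := by simp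
  rw [this] at h1
  push_cast at h1
  have hne : (-1 : ℂ) ^ k ≠ 0 := pow_ne_zero _ (by norm_num)
  apply mul_left_cancel₀ hne
  simp only [Nat.add_sub_cancel]
  rw [← h1]
  ring

theorem altD_branch {m : ℕ} (x : Fin (m + 1) → ℂ) (l : Fin (m + 1) → ℕ)
    (hl : ∀ j : Fin m, l j.castSucc < l j.succ) :
    altD x l = (-1) ^ m * x (Fin.last m) ^ l 0 * (∏ i : Fin m, (x i.castSucc - x (Fin.last m))) *
      ∑ s ∈ Fintype.piFinset (fun j : Fin m => Finset.Ico (l j.castSucc) (l j.succ)),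
        (∏ j : Fin m, x (Fin.last m) ^ (l j.succ - 1 - s j)) * altD (fun i : Fin m => x i.castSucc) s := by
  set y := x (Fin.last m) with hy
  let B : Matrix (Fin (m + 1)) (Fin (m + 1)) ℂ := Matrix.of fun j i =>
    Fin.cases (x i ^ l 0) (fun j => x i ^ l j.succ - x i ^ l j.castSucc * y ^ (l j.succ - l j.castSucc)) j
  have hB0 : ∀ i, B 0 i = x i ^ l 0 := fun i => rfl
  have hBs : ∀ (j : Fin m) i, B j.succ i = x i ^ l j.succ - x i ^ l j.castSucc * y ^ (l j.succ - l j.castSucc) := fun j i => rfl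
  have h1 : altD x l = B.det := by
    unfold altD
    apply Matrix.det_eq_of_forall_row_eq_smul_add_pred (fun j : Fin m => y ^ (l j.succ - l j.castSucc))
    · intro i; simp [hB0]
    · intro j i; simp only [hBs, Matrix.of_apply]; ring
  rw [h1, Matrix.det_succ_column B (Fin.last m), Fin.sum_univ_succ]
  have hz : ∀ j : Fin m, B j.succ (Fin.last m) = 0 := by
    intro j
    rw [hBs, ← hy, ← pow_add, Nat.add_sub_cancel' (hl j).le, sub_self]
  simp only [hz, hB0, mul_zero, zero_mul, Finset.sum_const_zero, add_zero]
  have h2 : (B.submatrix (Fin.succAbove 0) (Fin.succAbove (Fin.last m))).det =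
      (∏ i : Fin m, (x i.castSucc - y)) * (Matrix.detRowAlternating (n := Fin m) (R := ℂ))
        (fun j => ∑ s ∈ Finset.Ico (l j.castSucc) (l j.succ), y ^ (l j.succ - 1 - s) • (fun i : Fin m => x i.castSucc ^ s)) := by
    have hdet : ∀ M : Matrix (Fin m) (Fin m) ℂ, (Matrix.detRowAlternating (n := Fin m) (R := ℂ)) M = M.det := fun _ => rfl
    refine Eq.trans ?_ (congrArg _ (hdet (Matrix.of (fun (j : Fin m) => ∑ s ∈ Finset.Ico (l j.castSucc) (l j.succ), y ^ (l j.succ - 1 - s) • (fun i : Fin m => x i.castSucc ^ s)))).symm)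
    rw [← Matrix.det_mul_row]
    congr 1
    ext j i
    simp only [Matrix.submatrix_apply, Fin.succAbove_zero, Fin.succAbove_last, hBs, Matrix.of_apply]
    rw [← mul_geom_sum₂_Ico _ _ (hl j).le]
    simp only [Finset.sum_apply, Pi.smul_apply, smul_eq_mul]
    congr 1
    refine Finset.sum_congr rfl fun s _ => mul_comm _ _
  rw [h2]
  have h3 : (Matrix.detRowAlternating (n := Fin m) (R := ℂ))
        (fun j => ∑ s ∈ Finset.Ico (l j.castSucc) (l j.succ), y ^ (l j.succ - 1 - s) • (fun i : Fin m => x i.castSucc ^ s))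
      = ∑ s ∈ Fintype.piFinset (fun j : Fin m => Finset.Ico (l j.castSucc) (l j.succ)),
        (∏ j : Fin m, y ^ (l j.succ - 1 - s j)) * altD (fun i : Fin m => x i.castSucc) s := by
    have := (Matrix.detRowAlternating (n := Fin m) (R := ℂ)).toMultilinearMap.map_sum_finset
      (fun (j : Fin m) (s : ℕ) => y ^ (l j.succ - 1 - s) • (fun i : Fin m => x i.castSucc ^ s))
      (fun j : Fin m => Finset.Ico (l j.castSucc) (l j.succ))
    refine this.trans (Finset.sum_congr rfl fun s _ => ?_)
    rw [MultilinearMap.map_smul_univ]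
    rfl
  rw [h3, ← hy]
  simp only [Fin.val_zero, Fin.val_last, zero_add]
  ring

theorem altD_delta {m : ℕ} (x : Fin (m + 1) → ℂ) :
    altD x (fun j => (j : ℕ)) = (-1) ^ m * (∏ i : Fin m, (x i.castSucc - x (Fin.last m))) *
      altD (fun i : Fin m => x i.castSucc) (fun j => (j : ℕ)) := by
  rw [altD_branch x _ (by intro j; simp)]
  have : (Fintype.piFinset fun j : Fin m => Finset.Ico ((j.castSucc : Fin (m + 1)) : ℕ) ((j.succ : Fin (m + 1)) : ℕ)) = {fun j : Fin m => (j : ℕ)} := by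
    ext s
    simp only [Fintype.mem_piFinset, Finset.mem_Ico, Finset.mem_singleton, funext_iff, Fin.val_castSucc, Fin.val_succ]
    refine forall_congr' fun j => ?_
    omega
  rw [this, Finset.sum_singleton]
  simp

theorem mem_youngCells {m : ℕ} {lam : ℕ → ℕ} {p : ℕ × ℕ} :
    p ∈ youngCells m lam ↔ p.1 < m ∧ p.2 < lam p.1 := by
  obtain ⟨r, c⟩ := p
  simp [youngCells]

theorem prod_youngCells (m : ℕ) (lam : ℕ → ℕ) (F : ℕ × ℕ → ℂ) :
    ∏ p : {p // p ∈ youngCells m lam}, F p = ∏ r ∈ Finset.range m, ∏ c ∈ Finset.range (lam r), F (r, c) := by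
  rw [Finset.prod_coe_sort (youngCells m lam) F, Finset.prod_sigma']
  refine Finset.prod_bij' (fun p _ => ⟨p.1, p.2⟩) (fun p _ => (p.1, p.2)) ?_ ?_ ?_ ?_ ?_
  · intro p hp; simpa [mem_youngCells] using hp
  · intro p hp; simpa [mem_youngCells] using hp
  · intro p hp; rfl
  · intro p hp; rfl
  · intro p hp; rfl

/-- extend a weakly increasing list of row lengths (reversed) to a function on ℕ -/
def lamOf {m : ℕ} (μ : Fin m → ℕ) : ℕ → ℕ := fun r => if h : r < m then μ (Fin.rev ⟨r, h⟩) else 0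

theorem lamOf_rev {m : ℕ} (μ : Fin m → ℕ) (j : Fin m) : lamOf μ (m - 1 - j) = μ j := by
  have := j.2
  simp only [lamOf]
  rw [dif_pos (by omega)]
  congr 1
  ext
  simp only [Fin.val_rev]
  omega

theorem card_lower (N : ℕ) (P : ℕ → Prop) [DecidablePred P]
    (h : ∀ c, c < N → ∀ c', c' ≤ c → P c → P c') (c : ℕ) (hc : c < N) :
    P c ↔ c < ((Finset.range N).filter P).card := by
  constructor
  · intro hp
    have : Finset.range (c + 1) ⊆ (Finset.range N).filter P := by
      intro d hd
      simp only [Finset.mem_range, Finset.mem_filter] at hd ⊢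
      exact ⟨by omega, h c hc d (by omega) hp⟩
    have := Finset.card_le_card this
    rw [Finset.card_range] at this
    omega
  · intro hlt
    by_contra hp
    have : (Finset.range N).filter P ⊆ Finset.range c := by
      intro d hd
      simp only [Finset.mem_range, Finset.mem_filter] at hd ⊢
      by_contra hcd
      exact hp (h d hd.1 c (by omega) hd.2)
    have := Finset.card_le_card this
    rw [Finset.card_range] at this
    omega

theorem ssyt_row {m : ℕ} {lam : ℕ → ℕ} {T : {p // p ∈ youngCells m lam} → Fin m} (hT : IsSSYT T)
    (r c d : ℕ) (h1 : (r, c) ∈ youngCells m lam) (h2 : (r, c + d) ∈ youngCells m lam) :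
    T ⟨(r, c), h1⟩ ≤ T ⟨(r, c + d), h2⟩ := by
  induction d with
  | zero => exact le_rfl
  | succ d ih =>
    have h3 : (r, c + d) ∈ youngCells m lam := by
      rw [mem_youngCells] at *
      simp only at *
      omega
    exact (ih h3).trans (hT.1 ⟨(r, c + d), h3⟩ ⟨(r, c + (d + 1)), h2⟩ rfl rfl)

theorem ssyt_col {m : ℕ} {lam : ℕ → ℕ} (hlam : Antitone lam) {T : {p // p ∈ youngCells m lam} → Fin m} (hT : IsSSYT T)
    (r c : ℕ) (h1 : (r, c) ∈ youngCells m lam) : r ≤ (T ⟨(r, c), h1⟩ : ℕ) := by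
  induction r with
  | zero => exact Nat.zero_le _
  | succ r ih =>
    have h3 : (r, c) ∈ youngCells m lam := by
      have := hlam (Nat.le_succ r)
      rw [mem_youngCells] at *
      simp only [Nat.succ_eq_add_one] at *
      omega
    have := hT.2 ⟨(r, c), h3⟩ ⟨(r + 1, c), h1⟩ rfl rfl
    rw [Fin.lt_def] at this
    have := ih h3
    omega

open Classical in
def cntRow {m : ℕ} {lam : ℕ → ℕ} (T : {p // p ∈ youngCells (m + 1) lam} → Fin (m + 1)) (r : ℕ) : ℕ :=
  ((Finset.range (lam r)).filter (fun c => ∃ h : (r, c) ∈ youngCells (m + 1) lam, T ⟨(r, c), h⟩ ≠ Fin.last m)).card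

theorem cntRow_spec {m : ℕ} {lam : ℕ → ℕ} {T : {p // p ∈ youngCells (m + 1) lam} → Fin (m + 1)} (hT : IsSSYT T)
    (r c : ℕ) (h : (r, c) ∈ youngCells (m + 1) lam) : T ⟨(r, c), h⟩ ≠ Fin.last m ↔ c < cntRow T r := by
  classical
  have hc := (mem_youngCells.1 h).2
  have hr := (mem_youngCells.1 h).1
  simp only at hc hr
  have := card_lower (lam r) (fun c => ∃ h : (r, c) ∈ youngCells (m + 1) lam, T ⟨(r, c), h⟩ ≠ Fin.last m) ?_ c hc
  · unfold cntRow
    rw [← this]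
    exact ⟨fun h' => ⟨h, h'⟩, fun ⟨_, h'⟩ => h'⟩
  · rintro c hc c' hcc' ⟨h1, h2⟩
    obtain ⟨d, rfl⟩ := Nat.exists_eq_add_of_le hcc'
    have h3 : (r, c') ∈ youngCells (m + 1) lam := by rw [mem_youngCells]; exact ⟨hr, by simp only; omega⟩
    refine ⟨h3, fun h4 => h2 ?_⟩
    have := ssyt_row hT r c' d h3 h1
    rw [h4] at this
    exact le_antisymm (Fin.le_last _) this

theorem cntRow_le {m : ℕ} {lam : ℕ → ℕ} (T : {p // p ∈ youngCells (m + 1) lam} → Fin (m + 1)) (r : ℕ) :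
    cntRow T r ≤ lam r := by
  classical
  unfold cntRow
  exact (Finset.card_filter_le _ _).trans (by simp)

theorem le_cntRow {m : ℕ} {lam : ℕ → ℕ} (hlam : Antitone lam) {T : {p // p ∈ youngCells (m + 1) lam} → Fin (m + 1)} (hT : IsSSYT T)
    (r : ℕ) (hr : r < m) : lam (r + 1) ≤ cntRow T r := by
  by_contra hlt
  push Not at hlt
  have h1 : (r + 1, cntRow T r) ∈ youngCells (m + 1) lam := by rw [mem_youngCells]; exact ⟨by simp only; omega, hlt⟩
  have h0 : (r, cntRow T r) ∈ youngCells (m + 1) lam := by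
    rw [mem_youngCells]; exact ⟨by simp only; omega, lt_of_lt_of_le hlt (hlam (Nat.le_succ r))⟩
  have := hT.2 ⟨_, h0⟩ ⟨_, h1⟩ rfl rfl
  have h2 := (cntRow_spec hT _ _ h0).1 (fun h => by
    rw [h] at this
    exact absurd this (not_lt.2 (Fin.le_last _)))
  exact lt_irrefl _ h2

open Classical in
def extT {m : ℕ} {lam lam' : ℕ → ℕ} (T' : {p // p ∈ youngCells m lam'} → Fin m) :
    {p // p ∈ youngCells (m + 1) lam} → Fin (m + 1) :=
  fun p => if h : (p : ℕ × ℕ) ∈ youngCells m lam' then (T' ⟨p, h⟩).castSucc else Fin.last m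

theorem extT_isSSYT {m : ℕ} {lam lam' : ℕ → ℕ} 
    (hge : ∀ r, r < m → lam (r + 1) ≤ lam' r)
    {T' : {p // p ∈ youngCells m lam'} → Fin m} (hT' : IsSSYT T') :
    IsSSYT (extT T' : {p // p ∈ youngCells (m + 1) lam} → Fin (m + 1)) := by
  constructor
  · rintro ⟨⟨r, c⟩, hp⟩ ⟨⟨r', c'⟩, hq⟩ h1 h2
    simp only at h1 h2
    subst h1 h2
    by_cases hq' : (r, c + 1) ∈ youngCells m lam'
    · have hp' : (r, c) ∈ youngCells m lam' := by
        rw [mem_youngCells] at *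
        simp only at *
        omega
      simp only [extT, hp', hq', dif_pos]
      exact Fin.castSucc_le_castSucc_iff.2 (hT'.1 ⟨_, hp'⟩ ⟨_, hq'⟩ rfl rfl)
    · simp only [extT, hq']
      exact Fin.le_last _
  · rintro ⟨⟨r, c⟩, hp⟩ ⟨⟨r', c'⟩, hq⟩ h1 h2
    simp only at h1 h2
    subst h1 h2
    have hp' : (r, c) ∈ youngCells m lam' := by
      rw [mem_youngCells] at *
      simp only at *
      have := hge r (by omega)
      omega
    by_cases hq' : (r + 1, c) ∈ youngCells m lam'
    · simp only [extT, hp', hq', dif_pos]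
      exact Fin.castSucc_lt_castSucc_iff.2 (hT'.2 ⟨_, hp'⟩ ⟨_, hq'⟩ rfl rfl)
    · simp only [extT, hp', hq', dif_pos]
      exact Fin.castSucc_lt_last _

theorem cntRow_extT {m : ℕ} {lam lam' : ℕ → ℕ} 
    (hle : ∀ r, r < m → lam' r ≤ lam r)
    (T' : {p // p ∈ youngCells m lam'} → Fin m) (r : ℕ) (hr : r < m) :
    cntRow (extT T' : {p // p ∈ youngCells (m + 1) lam} → Fin (m + 1)) r = lam' r := by
  classical
  unfold cntRow
  have : (Finset.range (lam r)).filter (fun c => ∃ h : (r, c) ∈ youngCells (m + 1) lam,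
      (extT T' : {p // p ∈ youngCells (m + 1) lam} → Fin (m + 1)) ⟨(r, c), h⟩ ≠ Fin.last m) = Finset.range (lam' r) := by
    ext c
    simp only [Finset.mem_filter, Finset.mem_range]
    constructor
    · rintro ⟨h1, h2, h3⟩
      by_contra hc
      apply h3
      have : (r, c) ∉ youngCells m lam' := by
        rw [mem_youngCells]; exact fun h => hc h.2
      simp only [extT, this]
      rfl
    · intro hc
      have h1 : c < lam r := lt_of_lt_of_le hc (hle r hr)
      have h2 : (r, c) ∈ youngCells m lam' := by rw [mem_youngCells]; exact ⟨hr, hc⟩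
      refine ⟨h1, ?_, ?_⟩
      · rw [mem_youngCells]; exact ⟨by simp only; omega, h1⟩
      · simp only [extT, h2, dif_pos]
        exact (Fin.castSucc_lt_last _).ne
  rw [this, Finset.card_range]

theorem extT_inj {m : ℕ} {lam lam' : ℕ → ℕ} 
    (hle : ∀ r, r < m → lam' r ≤ lam r) :
    Function.Injective (extT : ({p // p ∈ youngCells m lam'} → Fin m) → {p // p ∈ youngCells (m + 1) lam} → Fin (m + 1)) := by
  intro T1 T2 h
  ext ⟨p, hp⟩
  have hp2 : p ∈ youngCells (m + 1) lam := by
    have h2 := mem_youngCells.1 hp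
    rw [mem_youngCells]
    exact ⟨by omega, lt_of_lt_of_le h2.2 (hle _ h2.1)⟩
  have := congrFun h ⟨p, hp2⟩
  simp only [extT, hp, dif_pos] at this
  rw [Fin.castSucc_inj.1 this]

theorem extT_surj {m : ℕ} {lam lam' : ℕ → ℕ} (hlam : Antitone lam)
    (hle : ∀ r, r < m → lam' r ≤ lam r)
    (T : {p // p ∈ youngCells (m + 1) lam} → Fin (m + 1)) (hT : IsSSYT T) (hc : ∀ r, r < m → cntRow T r = lam' r) :
    ∃ T' : {p // p ∈ youngCells m lam'} → Fin m, IsSSYT T' ∧ extT T' = T := by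
  have hsub : ∀ p, p ∈ youngCells m lam' → p ∈ youngCells (m + 1) lam := by
    intro p hp
    have h2 := mem_youngCells.1 hp
    rw [mem_youngCells]
    exact ⟨by omega, lt_of_lt_of_le h2.2 (hle _ h2.1)⟩
  have hne : ∀ p (hp : p ∈ youngCells (m + 1) lam), T ⟨p, hp⟩ ≠ Fin.last m ↔ p ∈ youngCells m lam' := by
    rintro ⟨r, c⟩ hp
    by_cases hr : r < m
    · rw [cntRow_spec hT, hc r hr, mem_youngCells]
      simp [hr]
    · have hm := mem_youngCells.1 hp
      have hrm : r = m := by simp only at hm; omega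
      rw [mem_youngCells]
      have := ssyt_col hlam hT r c hp
      have h3 : T ⟨(r, c), hp⟩ = Fin.last m := by
        apply le_antisymm (Fin.le_last _)
        rw [Fin.le_def, Fin.val_last]
        omega
      simp [hr, h3]
  refine ⟨fun p => (T ⟨p, hsub p p.2⟩).castPred ((hne _ _).2 p.2), ⟨?_, ?_⟩, ?_⟩
  · intro p q h1 h2
    have := hT.1 ⟨p, hsub p p.2⟩ ⟨q, hsub q q.2⟩ h1 h2
    simpa using this
  · intro p q h1 h2
    have := hT.2 ⟨p, hsub p p.2⟩ ⟨q, hsub q q.2⟩ h1 h2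
    simpa using this
  · ext ⟨p, hp⟩
    by_cases h : p ∈ youngCells m lam'
    · simp [extT, h]
    · have := (hne p hp).not.2 h
      push Not at this
      simp [extT, h, this]

theorem prod_extT {m : ℕ} {lam lam' : ℕ → ℕ} (hle : ∀ r, r < m → lam' r ≤ lam r)
    (x : Fin (m + 1) → ℂ) (T' : {p // p ∈ youngCells m lam'} → Fin m) :
    ∏ p : {p // p ∈ youngCells (m + 1) lam}, x (extT T' p) =
      x (Fin.last m) ^ lam m * (∏ r ∈ Finset.range m, x (Fin.last m) ^ (lam r - lam' r)) *
        ∏ p, x (T' p).castSucc := by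
  classical
  let F : ℕ × ℕ → ℂ := fun p => if h : p ∈ youngCells m lam' then x (T' ⟨p, h⟩).castSucc else x (Fin.last m)
  have h1 : ∀ p : {p // p ∈ youngCells (m + 1) lam}, x (extT T' p) = F p := by
    rintro ⟨p, hp⟩
    simp only [extT, F]
    split_ifs <;> rfl
  have h2 : ∀ p : {p // p ∈ youngCells m lam'}, x (T' p).castSucc = F p := by
    rintro ⟨p, hp⟩
    simp [F, hp]
  simp only [h1, h2]
  rw [prod_youngCells, prod_youngCells, Finset.prod_range_succ, mul_assoc, ← Finset.prod_mul_distrib, mul_comm]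
  congr 1
  · rw [Finset.prod_congr rfl (g := fun _ => x (Fin.last m)), Finset.prod_const, Finset.card_range]
    intro c _
    have : (m, c) ∉ youngCells m lam' := by rw [mem_youngCells]; simp
    simp [F, this]
  · refine Finset.prod_congr rfl fun r hr => ?_
    rw [Finset.mem_range] at hr
    rw [← Finset.prod_range_mul_prod_Ico _ (hle r hr), mul_comm]
    congr 1
    rw [Finset.prod_congr rfl (g := fun _ => x (Fin.last m)), Finset.prod_const, Nat.card_Ico]
    intro c hc
    rw [Finset.mem_Ico] at hc
    have : (r, c) ∉ youngCells m lam' := by rw [mem_youngCells]; simp only; omega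
    simp [F, this]

theorem schur_branch {m : ℕ} (lam : ℕ → ℕ) (hlam : Antitone lam) (x : Fin (m + 1) → ℂ) :
    schur (m + 1) lam x = ∑ μ ∈ Fintype.piFinset (fun j : Fin m => Finset.Icc (lam (m - j)) (lam (m - 1 - j))),
      x (Fin.last m) ^ lam m * (∏ j : Fin m, x (Fin.last m) ^ (lam (m - 1 - j) - μ j)) *
        schur m (lamOf μ) (fun i => x i.castSucc) := by
  classical
  unfold schur
  rw [← Finset.sum_fiberwise_of_maps_to (g := fun T (j : Fin m) => cntRow T (m - 1 - j))
    (t := Fintype.piFinset (fun j : Fin m => Finset.Icc (lam (m - j)) (lam (m - 1 - j))))]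
  · refine Finset.sum_congr rfl fun μ hμ => ?_
    have hμ' : ∀ r, r < m → lam (r + 1) ≤ lamOf μ r ∧ lamOf μ r ≤ lam r := by
      intro r hr
      have := Fintype.mem_piFinset.1 hμ (Fin.rev ⟨r, hr⟩)
      rw [Finset.mem_Icc, Fin.val_rev] at this
      simp only at this
      rw [lamOf, dif_pos hr]
      rw [show m - (m - (r + 1)) = r + 1 by omega, show m - 1 - (m - (r + 1)) = r by omega] at this
      exact this
    have hle : ∀ r, r < m → lamOf μ r ≤ lam r := fun r hr => (hμ' r hr).2
    rw [Finset.mul_sum]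
    symm
    apply Finset.sum_bij (fun T' _ => extT T')
    · intro T' hT'
      simp only [ssytFinset, Finset.mem_filter, Finset.mem_univ, true_and] at hT' ⊢
      refine ⟨extT_isSSYT (fun r hr => (hμ' r hr).1) hT', ?_⟩
      ext j
      rw [cntRow_extT hle _ _ (by have := j.2; omega), lamOf_rev]
    · intro T1 _ T2 _ h
      exact extT_inj hle h
    · intro T hT
      simp only [ssytFinset, Finset.mem_filter, Finset.mem_univ, true_and] at hT
      obtain ⟨T', h1, h2⟩ := extT_surj hlam hle T hT.1 (by
        intro r hr
        have := congrFun hT.2 (Fin.rev ⟨r, hr⟩)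
        rw [lamOf, dif_pos hr, ← this]
        simp only [Fin.val_rev]
        congr 1
        omega)
      exact ⟨T', by simp [ssytFinset, h1], h2⟩
    · intro T' _
      rw [prod_extT hle]
      congr 2
      rw [Finset.prod_range, ← Equiv.prod_comp Fin.revPerm]
      refine Finset.prod_congr rfl fun j _ => ?_
      have := j.2
      simp only [Fin.revPerm_apply, Fin.val_rev, lamOf, j.2, dif_pos]
      rw [show m - 1 - (m - (j + 1)) = (j : ℕ) by omega]
  · intro T hT
    simp only [ssytFinset, Finset.mem_filter, Finset.mem_univ, true_and] at hT
    rw [Fintype.mem_piFinset]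
    intro j
    rw [Finset.mem_Icc]
    have := j.2
    refine ⟨?_, cntRow_le _ _⟩
    have h := le_cntRow hlam hT (m - 1 - j) (by omega)
    rwa [show m - 1 - (j : ℕ) + 1 = m - j by omega] at h

theorem bialternant : ∀ (m : ℕ) (lam : ℕ → ℕ) (_ : Antitone lam) (x : Fin m → ℂ),
    schur m lam x * altD x (fun j => (j : ℕ)) = altD x (fun j => lam (m - 1 - j) + j) := by
  intro m
  induction m with
  | zero =>
    intro lam _ x
    have h1 : schur 0 lam x = 1 := by
      have : IsEmpty {p // p ∈ youngCells 0 lam} := ⟨fun p => by have := (mem_youngCells.1 p.2).1; omega⟩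
      have : ssytFinset 0 lam = Finset.univ := by
        ext T
        simp only [ssytFinset, Finset.mem_filter, Finset.mem_univ, true_and, iff_true]
        exact ⟨fun p => isEmptyElim p, fun p => isEmptyElim p⟩
      simp [schur, this]
    rw [h1, one_mul]
    congr 1
    ext j
    exact j.elim0
  | succ m ih =>
    intro lam hlam x
    rw [altD_branch x (fun j => lam (m + 1 - 1 - j) + j), altD_delta, schur_branch lam hlam, Finset.sum_mul, Finset.mul_sum]
    · simp only [Fin.val_castSucc, Fin.val_succ, Fin.val_zero, Nat.add_sub_cancel, Nat.sub_zero, Nat.add_zero]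
      refine Finset.sum_bij' (fun μ _ j => μ j + (j : ℕ)) (fun s _ j => s j - (j : ℕ)) ?_ ?_ ?_ ?_ ?_
      · intro μ hμ
        rw [Fintype.mem_piFinset] at *
        intro j
        have h := hμ j
        have := j.2
        rw [Finset.mem_Ico]
        rw [Finset.mem_Icc] at h
        rw [show m - ((j : ℕ) + 1) = m - 1 - j by omega]
        omega
      · intro s hs
        rw [Fintype.mem_piFinset] at *
        intro j
        have h := hs j
        have := j.2
        rw [Finset.mem_Icc]
        rw [Finset.mem_Ico] at h
        rw [show m - ((j : ℕ) + 1) = m - 1 - j by omega] at h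
        omega
      · intro μ hμ
        ext j
        simp
      · intro s hs
        ext j
        have h := Fintype.mem_piFinset.1 hs j
        rw [Finset.mem_Ico] at h
        simp only
        omega
      · intro μ hμ
        rw [Fintype.mem_piFinset] at hμ
        have hanti : Antitone (lamOf μ) := by
          apply antitone_nat_of_succ_le
          intro r
          unfold lamOf
          by_cases h : r + 1 < m
          · rw [dif_pos h, dif_pos (by omega)]
            have h1 := Finset.mem_Icc.1 (hμ (Fin.rev ⟨r + 1, h⟩))
            have h2 := Finset.mem_Icc.1 (hμ (Fin.rev ⟨r, by omega⟩))
            simp only [Fin.val_rev] at h1 h2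
            rw [show m - 1 - (m - (r + 1 + 1)) = m - (m - (r + 1)) by omega] at h1
            omega
          · rw [dif_neg h]; exact Nat.zero_le _
        have hih := ih (lamOf μ) hanti (fun i => x i.castSucc)
        simp only [lamOf_rev] at hih
        rw [← hih]
        have he : ∏ j : Fin m, x (Fin.last m) ^ (lam (m - ((j : ℕ) + 1)) + ((j : ℕ) + 1) - 1 - (μ j + (j : ℕ))) =
            ∏ j : Fin m, x (Fin.last m) ^ (lam (m - 1 - (j : ℕ)) - μ j) := by
          refine Finset.prod_congr rfl fun j _ => ?_
          have := j.2
          congr 1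
          rw [show m - ((j : ℕ) + 1) = m - 1 - j by omega]
          omega
        rw [he]
        ring
    · intro j
      simp only [Fin.val_castSucc, Fin.val_succ, Nat.add_sub_cancel]
      have := hlam (show m - ((j : ℕ) + 1) ≤ m - j by omega)
      omega

/-- logarithmic derivative of the potential at position `(i,j)` -/
def balB (k m : ℕ) (x : ℕ × ℕ → ℂ) (i j : ℕ) : ℂ :=
  (if i < k then x (i, j) / x (i + 1, j) else 0) - (if 1 < i then x (i - 1, j) / x (i, j) else 0)
  + (if 1 < j then x (i, j) / x (i, j - 1) else 0) - (if j < m then x (i, j + 1) / x (i, j) else 0)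
  - (if i = 1 ∧ j = m then 1 / x (i, j) else 0) + (if i = k ∧ j = 1 then x (i, j) else 0)

theorem sum_lt_ite (k : ℕ) (f : ℕ → ℂ) :
    ∑ i ∈ Finset.Icc 1 k, (if i < k then f i else 0) = ∑ i ∈ Finset.Icc 1 (k - 1), f i := by
  rw [← Finset.sum_filter]
  congr 1
  ext i
  simp only [Finset.mem_filter, Finset.mem_Icc]
  omega

theorem sum_gt_ite (k : ℕ) (f : ℕ → ℂ) :
    ∑ i ∈ Finset.Icc 1 k, (if 1 < i then f i else 0) = ∑ i ∈ Finset.Icc 1 (k - 1), f (i + 1) := by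
  rw [← Finset.sum_filter]
  refine Finset.sum_bij' (fun i _ => i - 1) (fun i _ => i + 1) ?_ ?_ ?_ ?_ ?_
  · intro i hi
    simp only [Finset.mem_filter, Finset.mem_Icc] at *
    omega
  · intro i hi
    simp only [Finset.mem_filter, Finset.mem_Icc] at *
    omega
  · intro i hi
    simp only [Finset.mem_filter, Finset.mem_Icc] at *
    omega
  · intro i hi
    simp
  · intro i hi
    simp only [Finset.mem_filter, Finset.mem_Icc] at *
    rw [Nat.sub_add_cancel (by omega)]

theorem sum_sum_ite (A B : Finset ℕ) (i j : ℕ) (g : ℕ → ℕ → ℂ) :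
    ∑ i' ∈ A, ∑ j' ∈ B, (if i' = i ∧ j' = j then g i' j' else 0) = if i ∈ A ∧ j ∈ B then g i j else 0 := by
  simp only [ite_and]
  have : ∀ i' ∈ A, (∑ j' ∈ B, if i' = i then (if j' = j then g i' j' else 0) else 0) =
     if i' = i then (if j ∈ B then g i j else 0) else 0 := by
    intro i' _
    split_ifs with h h'
    · subst h; simp [h']
    · subst h; simp [h']
    · simp
  rw [Finset.sum_congr rfl this]
  simp

theorem sum_by_parts (k m : ℕ) (hk : 1 ≤ k) (hm : 1 ≤ m) (x : ℕ × ℕ → ℂ) (φ : ℕ → ℕ → ℂ) :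
    ∑ i ∈ Finset.Icc 1 k, ∑ j ∈ Finset.Icc 1 m, φ i j * balB k m x i j =
      (∑ i ∈ Finset.Icc 1 (k - 1), ∑ j ∈ Finset.Icc 1 m, (φ i j - φ (i + 1) j) * (x (i, j) / x (i + 1, j)))
      + (∑ i ∈ Finset.Icc 1 k, ∑ j ∈ Finset.Icc 1 (m - 1), (φ i (j + 1) - φ i j) * (x (i, j + 1) / x (i, j)))
      - φ 1 m * (1 / x (1, m)) + φ k 1 * x (k, 1) := by
  simp only [balB, mul_add, mul_sub, sub_mul, Finset.sum_add_distrib, Finset.sum_sub_distrib, mul_ite, mul_zero]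
  have e1 : ∑ i ∈ Finset.Icc 1 k, ∑ j ∈ Finset.Icc 1 m, (if i < k then φ i j * (x (i, j) / x (i + 1, j)) else 0)
      = ∑ i ∈ Finset.Icc 1 (k - 1), ∑ j ∈ Finset.Icc 1 m, φ i j * (x (i, j) / x (i + 1, j)) := by
    rw [← sum_lt_ite]
    refine Finset.sum_congr rfl fun i _ => ?_
    split_ifs <;> simp
  have e2 : ∑ i ∈ Finset.Icc 1 k, ∑ j ∈ Finset.Icc 1 m, (if 1 < i then φ i j * (x (i - 1, j) / x (i, j)) else 0)
      = ∑ i ∈ Finset.Icc 1 (k - 1), ∑ j ∈ Finset.Icc 1 m, φ (i + 1) j * (x (i, j) / x (i + 1, j)) := by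
    refine Eq.trans ?_ (sum_gt_ite k (fun i => ∑ j ∈ Finset.Icc 1 m, φ i j * (x (i - 1, j) / x (i, j))))
    refine Finset.sum_congr rfl fun i _ => ?_
    split_ifs <;> simp
  have e3 : ∑ i ∈ Finset.Icc 1 k, ∑ j ∈ Finset.Icc 1 m, (if 1 < j then φ i j * (x (i, j) / x (i, j - 1)) else 0)
      = ∑ i ∈ Finset.Icc 1 k, ∑ j ∈ Finset.Icc 1 (m - 1), φ i (j + 1) * (x (i, j + 1) / x (i, j)) := by
    refine Finset.sum_congr rfl fun i _ => ?_
    rw [sum_gt_ite m (fun j => φ i j * (x (i, j) / x (i, j - 1)))]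
    simp
  have e4 : ∑ i ∈ Finset.Icc 1 k, ∑ j ∈ Finset.Icc 1 m, (if j < m then φ i j * (x (i, j + 1) / x (i, j)) else 0)
      = ∑ i ∈ Finset.Icc 1 k, ∑ j ∈ Finset.Icc 1 (m - 1), φ i j * (x (i, j + 1) / x (i, j)) := by
    refine Finset.sum_congr rfl fun i _ => ?_
    rw [sum_lt_ite m (fun j => φ i j * (x (i, j + 1) / x (i, j)))]
  have e5 := sum_sum_ite (Finset.Icc 1 k) (Finset.Icc 1 m) 1 m (fun i j => φ i j * (1 / x (i, j)))
  have e6 := sum_sum_ite (Finset.Icc 1 k) (Finset.Icc 1 m) k 1 (fun i j => φ i j * x (i, j))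
  rw [if_pos (by simp only [Finset.mem_Icc]; omega)] at e5 e6
  rw [e1, e2, e3, e4, e5, e6]
  ring

theorem hasDerivAt_gc (k m : ℕ) (x : ℕ × ℕ → ℂ)
    (hx : ∀ i j : ℕ, 1 ≤ i → i ≤ k → 1 ≤ j → j ≤ m → x (i, j) ≠ 0)
    (i j : ℕ) (hi : 1 ≤ i) (hik : i ≤ k) (hj : 1 ≤ j) (hjm : j ≤ m) :
    HasDerivAt (fun t : ℂ => gcPotential k m (Function.update x (i, j) t)) (balB k m x i j / x (i, j)) (x (i, j)) := by
  have hu : ∀ p, HasDerivAt (fun t : ℂ => Function.update x (i, j) t p) (if p = (i, j) then (1 : ℂ) else 0) (x (i, j)) := by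
    intro p
    by_cases h : p = (i, j)
    · subst h
      have h : (fun t : ℂ => Function.update x (i, j) t (i, j)) = fun t => t := by ext t; simp
      rw [h, if_pos rfl]
      exact hasDerivAt_id' _
    · simp only [Function.update_of_ne h, if_neg h]
      exact hasDerivAt_const _ _
  have hup : ∀ p, Function.update x (i, j) (x (i, j)) p = x p := by
    intro p; rw [Function.update_eq_self]
  have hdiv : ∀ p q, x q ≠ 0 → HasDerivAt (fun t : ℂ => Function.update x (i, j) t p / Function.update x (i, j) t q)
      ((if p = (i, j) then 1 / x q else 0) - (if q = (i, j) then x p / x q ^ 2 else 0)) (x (i, j)) := by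
    intro p q hq
    have := (hu p).div (hu q) (by rw [hup]; exact hq)
    simp only [hup] at this
    refine HasDerivAt.congr_deriv this ?_
    split_ifs <;> field_simp <;> simp
  have d1 : HasDerivAt (fun t : ℂ => ∑ i' ∈ Finset.Icc 1 (k - 1), ∑ j' ∈ Finset.Icc 1 m,
      Function.update x (i, j) t (i', j') / Function.update x (i, j) t (i' + 1, j'))
      (∑ i' ∈ Finset.Icc 1 (k - 1), ∑ j' ∈ Finset.Icc 1 m,
        ((if (i', j') = (i, j) then 1 / x (i' + 1, j') else 0) - (if (i' + 1, j') = (i, j) then x (i', j') / x (i' + 1, j') ^ 2 else 0))) (x (i, j)) := by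
    refine HasDerivAt.fun_sum fun i' hi' => HasDerivAt.fun_sum fun j' hj' => ?_
    rw [Finset.mem_Icc] at hi' hj'
    exact hdiv _ _ (hx _ _ (by omega) (by omega) (by omega) (by omega))
  have d2 : HasDerivAt (fun t : ℂ => ∑ i' ∈ Finset.Icc 1 k, ∑ j' ∈ Finset.Icc 1 (m - 1),
      Function.update x (i, j) t (i', j' + 1) / Function.update x (i, j) t (i', j'))
      (∑ i' ∈ Finset.Icc 1 k, ∑ j' ∈ Finset.Icc 1 (m - 1),
        ((if (i', j' + 1) = (i, j) then 1 / x (i', j') else 0) - (if (i', j') = (i, j) then x (i', j' + 1) / x (i', j') ^ 2 else 0))) (x (i, j)) := by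
    refine HasDerivAt.fun_sum fun i' hi' => HasDerivAt.fun_sum fun j' hj' => ?_
    rw [Finset.mem_Icc] at hi' hj'
    exact hdiv _ _ (hx _ _ (by omega) (by omega) (by omega) (by omega))
  have d3 : HasDerivAt (fun t : ℂ => 1 / Function.update x (i, j) t (1, m))
      (- (if (1, m) = (i, j) then 1 / x (1, m) ^ 2 else 0)) (x (i, j)) := by
    have := (hasDerivAt_const (x (i, j)) (1 : ℂ)).div (hu (1, m)) (by rw [hup]; exact hx _ _ (by omega) (by omega) (by omega) (by omega))
    simp only [hup] at this
    refine HasDerivAt.congr_deriv this ?_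
    split_ifs <;> simp [neg_div]
  have d := ((d1.add d2).add d3).add (hu (k, 1))
  unfold gcPotential
  refine d.congr_deriv ?_
  simp only [Finset.sum_sub_distrib, Prod.mk.injEq]
  have r1 : ∀ i' j' : ℕ, (i' + 1 = i ∧ j' = j) ↔ (i' = i - 1 ∧ j' = j) := by intros; omega
  have r2 : ∀ i' j' : ℕ, (i' = i ∧ j' + 1 = j) ↔ (i' = i ∧ j' = j - 1) := by intros; omega
  simp only [r1, r2]
  rw [sum_sum_ite _ _ _ _ (fun i' j' => 1 / x (i' + 1, j')), sum_sum_ite _ _ _ _ (fun i' j' => x (i', j') / x (i' + 1, j') ^ 2),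
    sum_sum_ite _ _ _ _ (fun i' j' => 1 / x (i', j')), sum_sum_ite _ _ _ _ (fun i' j' => x (i', j' + 1) / x (i', j') ^ 2)]
  have h0 := hx i j hi hik hj hjm
  have c1 : (i ∈ Finset.Icc 1 (k - 1) ∧ j ∈ Finset.Icc 1 m) ↔ i < k := by simp only [Finset.mem_Icc]; omega
  have c2 : (i - 1 ∈ Finset.Icc 1 (k - 1) ∧ j ∈ Finset.Icc 1 m) ↔ 1 < i := by simp only [Finset.mem_Icc]; omega
  have c3 : (i ∈ Finset.Icc 1 k ∧ j - 1 ∈ Finset.Icc 1 (m - 1)) ↔ 1 < j := by simp only [Finset.mem_Icc]; omega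
  have c4 : (i ∈ Finset.Icc 1 k ∧ j ∈ Finset.Icc 1 (m - 1)) ↔ j < m := by simp only [Finset.mem_Icc]; omega
  have c5 : (0 = i - 1 ∧ m = j) ↔ (i = 1 ∧ j = m) := by omega
  have c6 : (k = i ∧ 0 = j - 1) ↔ (i = k ∧ j = 1) := by omega
  rw [if_congr c1 rfl rfl, if_congr c2 rfl rfl, if_congr c3 rfl rfl, if_congr c4 rfl rfl, if_congr c5 rfl rfl, if_congr c6 rfl rfl]
  have g1 : i - 1 + 1 = i := by omega
  rw [g1]
  unfold balB
  simp only [add_div, sub_div, ite_div, zero_div]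
  have f1 : x (i, j) / x (i + 1, j) / x (i, j) = 1 / x (i + 1, j) := by field_simp
  have f2 : x (i - 1, j) / x (i, j) / x (i, j) = x (i - 1, j) / x (i, j) ^ 2 := by field_simp
  have f3 : x (i, j) / x (i, j - 1) / x (i, j) = 1 / x (i, j - 1) := by field_simp
  have f4 : x (i, j + 1) / x (i, j) / x (i, j) = x (i, j + 1) / x (i, j) ^ 2 := by field_simp
  have f5 : 1 / x (i, j) / x (i, j) = 1 / x (i, j) ^ 2 := by field_simp
  rw [f1, f2, f3, f4, f5, div_self h0]
  have f6 : (if i = 1 ∧ j = m then 1 / x (1, m) ^ 2 else 0) = (if i = 1 ∧ j = m then 1 / x (i, j) ^ 2 else 0) := by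
    split_ifs with h
    · rw [h.1, h.2]
    · rfl
  rw [f6]
  ring

theorem balance (k m : ℕ) (R : ℕ → ℕ → ℂ) (x : ℕ × ℕ → ℂ)
    (hxR : ∀ a j, a + 1 ≤ k → x (k - a, j + 1) = R (a + 1) (j + 1) / R a j)
    (hne : ∀ a b, a ≤ k → b ≤ m → R a b ≠ 0)
    (h0 : ∀ b, R 0 b = 1) (h0' : ∀ a, R a 0 = 1)
    (hD : ∀ a b, a + 1 < k → R (a + 1) (b + 1) ^ 2 = R (a + 2) (b + 1) * R a (b + 1) + R (a + 1) (b + 2) * R (a + 1) b)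
    (hF : ∀ b, R k (b + 1) ^ 2 = R k (b + 2) * R k b)
    (hV : ∀ a, 1 ≤ a → a < k → R a (m + 1) = 0)
    (hW : R k (m + 1) = R (k - 1) m)
    (a j : ℕ) (ha : a + 1 ≤ k) (hj : j + 1 ≤ m) : balB k m x (k - a) (j + 1) = 0 := by
  have n1 := hne (a + 1) (j + 1) (by omega) (by omega)
  have n2 := hne a j (by omega) (by omega)
  have n3 := hne a (j + 1) (by omega) (by omega)
  have n4 := hne (a + 1) j (by omega) (by omega)
  have hin : (if k - a < k then x (k - a, j + 1) / x (k - a + 1, j + 1) else 0)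
      + (if 1 < j + 1 then x (k - a, j + 1) / x (k - a, j + 1 - 1) else 0)
      + (if k - a = k ∧ j + 1 = 1 then x (k - a, j + 1) else 0)
      = R (a + 1) (j + 1) * R a j / (R a (j + 1) * R (a + 1) j) := by
    rcases a with _ | a
    · rcases j with _ | j
      · rw [if_neg (by omega), if_neg (by omega), if_pos (by omega), hxR _ _ (by omega)]
        simp [h0, h0']
      · rw [if_neg (by omega), if_pos (by omega), if_neg (by omega), Nat.add_sub_cancel, hxR _ _ (by omega), hxR _ _ (by omega)]
        simp [h0, h0']
    · have hk : k - (a + 1) + 1 = k - a := by omega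
      rcases j with _ | j
      · rw [if_pos (by omega), if_neg (by omega), if_neg (by omega), hk, hxR _ _ (by omega), hxR _ _ (by omega)]
        simp [h0, h0']
      · rw [if_pos (by omega), if_pos (by omega), if_neg (by omega), hk, Nat.add_sub_cancel, hxR _ _ (by omega), hxR _ _ (by omega), hxR _ _ (by omega)]
        have D := hD a j (by omega)
        have n5 := hne a (j + 1) (by omega) (by omega)
        have n6 := hne (a + 1) j (by omega) (by omega)
        simp only [add_assoc, Nat.reduceAdd] at *
        field_simp
        linear_combination -R (a + 2) (j + 2) * D
  have hout : (if 1 < k - a then x (k - a - 1, j + 1) / x (k - a, j + 1) else 0)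
      + (if j + 1 < m then x (k - a, j + 1 + 1) / x (k - a, j + 1) else 0)
      + (if k - a = 1 ∧ j + 1 = m then 1 / x (k - a, j + 1) else 0)
      = R (a + 1) (j + 1) * R a j / (R a (j + 1) * R (a + 1) j) := by
    rcases Nat.lt_or_ge (a + 1) k with hak | hak
    · have hk : k - a - 1 = k - (a + 1) := by omega
      have D := hD a j hak
      rcases Nat.lt_or_ge (j + 1) m with hjm | hjm
      · rw [if_pos (by omega), if_pos (by omega), if_neg (by omega), hk, hxR _ _ (by omega), hxR _ _ (by omega), hxR _ _ (by omega)]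
        simp only [add_assoc, Nat.reduceAdd] at *
        field_simp
        linear_combination -R a j * D
      · rw [if_pos (by omega), if_neg (by omega), if_neg (by omega), hk, hxR _ _ (by omega), hxR _ _ (by omega)]
        have hv := hV (a + 1) (by omega) hak
        rw [show m + 1 = j + 2 by omega] at hv
        rw [hv] at D
        simp only [add_assoc, Nat.reduceAdd] at *
        field_simp
        linear_combination -R a j * D
    · have hka : k = a + 1 := by omega
      have D := hF j
      rw [hka] at D
      rcases Nat.lt_or_ge (j + 1) m with hjm | hjm
      · rw [if_neg (by omega), if_pos (by omega), if_neg (by omega), hxR _ _ (by omega), hxR _ _ (by omega)]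
        simp only [add_assoc, Nat.reduceAdd] at *
        field_simp
        linear_combination -R a j * D
      · rw [if_neg (by omega), if_neg (by omega), if_pos (by omega), hxR _ _ (by omega)]
        have hw := hW
        rw [hka, show m + 1 = j + 2 by omega, Nat.add_sub_cancel, show m = j + 1 by omega] at hw
        rw [hw] at D
        simp only [add_assoc, Nat.reduceAdd] at *
        field_simp
        linear_combination -R a j * D
  unfold balB
  linear_combination hin - hout

theorem schur_one (k : ℕ) (hk : 1 ≤ k) (x : Fin k → ℂ) : schur k (rectPart 1 1) x = ∑ i, x i := by
  have hm : ∀ p, p ∈ youngCells k (rectPart 1 1) ↔ p = (0, 0) := by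
    rintro ⟨r, c⟩
    rw [mem_youngCells]
    simp only [rectPart, Prod.mk.injEq]
    split_ifs <;> omega
  let u : Unique {p // p ∈ youngCells k (rectPart 1 1)} :=
    { default := ⟨(0, 0), (hm _).2 rfl⟩
      uniq := fun p => Subtype.ext ((hm _).1 p.2) }
  have hs : ssytFinset k (rectPart 1 1) = Finset.univ := by
    ext T
    simp only [ssytFinset, Finset.mem_filter, Finset.mem_univ, true_and, iff_true]
    constructor
    · intro p q _ h
      have h1 := (hm _).1 p.2
      have h2 := (hm _).1 q.2
      rw [h1, h2] at h
      simp at h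
    · intro p q _ h
      have h1 := (hm _).1 p.2
      have h2 := (hm _).1 q.2
      rw [h1, h2] at h
      simp at h
  unfold schur
  rw [hs]
  rw [← Equiv.sum_comp (Equiv.funUnique {p // p ∈ youngCells k (rectPart 1 1)} (Fin k)) x]
  refine Finset.sum_congr rfl fun T _ => ?_
  rw [Fintype.prod_unique]
  rfl

theorem altD_delta_ne {k : ℕ} (x : Fin k → ℂ) (hx : Function.Injective x) : altD x (fun j => (j : ℕ)) ≠ 0 := by
  have : altD x (fun j => (j : ℕ)) = (Matrix.vandermonde x).det := by
    rw [← Matrix.det_transpose]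
    rfl
  rw [this]
  exact Matrix.det_vandermonde_ne_zero_iff.2 hx

theorem rect_altD {k : ℕ} (x : Fin k → ℂ) (a b : ℕ) :
    schur k (rectPart a b) x * altD x (fun j => (j : ℕ)) = altD x (rexp k a b) := by
  rw [bialternant]
  · congr 1
    ext j
    have := j.2
    simp only [rectPart, rexp]
    split_ifs <;> omega
  · intro r s hrs
    simp only [rectPart]
    split_ifs <;> omega

/-- For a root set `I` of type `(k,n)` all of whose rectangular Schur evaluations are
nonzero, the point `x*` with coordinates `S_{(j^{k+1−i})}(I)/S_{((j−1)^{k−i})}(I)` has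
nonzero coordinates, is a critical point of the Maslov 2 disk potential of the
Gelfand–Cetlin torus, and the critical value is `n·Σ_{ζ∈I} ζ`. -/
theorem xstar_critical_point (n k : ℕ) (hn : 2 ≤ n) (hk1 : 1 ≤ k) (hk2 : k ≤ n - 1)
    (I : Finset ℂ) (hI : IsRootSet k n I)
    (hS : ∀ a b : ℕ, 1 ≤ a → a ≤ k → 1 ≤ b → b ≤ n - k →
      schurSet (rectPart a b) I ≠ 0) :
    (∀ i j : ℕ, 1 ≤ i → i ≤ k → 1 ≤ j → j ≤ n - k → xstar k I (i, j) ≠ 0) ∧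
    (∀ i j : ℕ, 1 ≤ i → i ≤ k → 1 ≤ j → j ≤ n - k →
      HasDerivAt
        (fun t : ℂ => gcPotential k (n - k) (Function.update (xstar k I) (i, j) t))
        0 (xstar k I (i, j))) ∧
    gcPotential k (n - k) (xstar k I) = n * ∑ z ∈ I, z := by
  obtain ⟨hcard, hroot⟩ := hI
  subst hcard
  set k := I.card with hk
  set x : Fin k → ℂ := fun i => (I.equivFin.symm i : ℂ) with hx
  have hinj : Function.Injective x := fun i j h => I.equivFin.symm.injective (Subtype.ext h)
  have hxn : ∀ i, x i ^ n = (-1) ^ (k + 1) := fun i => hroot _ (I.equivFin.symm i).2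
  have hx0 : ∀ i, x i ≠ 0 := by
    intro i h
    have h1 := hxn i
    rw [h, zero_pow (by omega)] at h1
    exact pow_ne_zero _ (by norm_num) h1.symm
  have hprod : ∏ i, x i ≠ 0 := Finset.prod_ne_zero_iff.2 fun i _ => hx0 i
  have hΔ := altD_delta_ne x hinj
  set Δ := altD x (fun j => (j : ℕ)) with hΔdef
  set R : ℕ → ℕ → ℂ := fun a b => schurSet (rectPart a b) I with hR
  have hRA : ∀ a b, R a b * Δ = altD x (rexp k a b) := fun a b => rect_altD x a b
  have h0 : ∀ b, R 0 b = 1 := by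
    intro b
    apply mul_right_cancel₀ hΔ
    rw [hRA, one_mul, hΔdef]
    congr 1
    ext j
    simp [rexp]
  have h0' : ∀ a, R a 0 = 1 := by
    intro a
    apply mul_right_cancel₀ hΔ
    rw [hRA, one_mul, hΔdef]
    congr 1
    ext j
    simp [rexp]
  have hne : ∀ a b, a ≤ k → b ≤ n - k → R a b ≠ 0 := by
    intro a b ha hb
    rcases Nat.eq_zero_or_pos a with rfl | ha'
    · rw [h0]; exact one_ne_zero
    rcases Nat.eq_zero_or_pos b with rfl | hb'
    · rw [h0']; exact one_ne_zero
    exact hS a b ha' ha hb' hb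
  have hD : ∀ a b, a + 1 < k → R (a + 1) (b + 1) ^ 2 = R (a + 2) (b + 1) * R a (b + 1) + R (a + 1) (b + 2) * R (a + 1) b := by
    intro a b hak
    have D := dodgson x hprod (a + 1) (b + 1) (by omega) hak (by omega)
    simp only [Nat.add_sub_cancel, ← hRA] at D
    apply mul_right_cancel₀ (pow_ne_zero 2 hΔ)
    linear_combination D
  have hF' : ∀ b, R k b = (∏ i, x i) ^ b := by
    intro b
    apply mul_right_cancel₀ hΔ
    rw [hRA, altD_full]
  have hF : ∀ b, R k (b + 1) ^ 2 = R k (b + 2) * R k b := by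
    intro b
    rw [hF', hF', hF']
    ring
  have hV : ∀ a, 1 ≤ a → a < k → R a (n - k + 1) = 0 := by
    intro a ha hak
    apply mul_right_cancel₀ hΔ
    rw [hRA, zero_mul, altD_vanish _ x hxn (by omega) a ha hak]
  have hW : R k (n - k + 1) = R (k - 1) (n - k) := by
    apply mul_right_cancel₀ hΔ
    rw [hRA, hRA, altD_rot hk1 x hxn (by omega)]
  have hxR : ∀ a j, a + 1 ≤ k → xstar k I (k - a, j + 1) = R (a + 1) (j + 1) / R a j := by
    intro a j ha
    simp only [xstar, hR]
    rw [show k + 1 - (k - a) = a + 1 by omega, show k - (k - a) = a by omega, Nat.add_sub_cancel]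
  have hbal : ∀ i j : ℕ, 1 ≤ i → i ≤ k → 1 ≤ j → j ≤ n - k → balB k (n - k) (xstar k I) i j = 0 := by
    intro i j hi hik hj hjm
    have := balance k (n - k) R (xstar k I) hxR hne h0 h0' hD hF hV hW (k - i) (j - 1) (by omega) (by omega)
    rwa [show k - (k - i) = i by omega, Nat.sub_add_cancel hj] at this
  have hxne : ∀ i j : ℕ, 1 ≤ i → i ≤ k → 1 ≤ j → j ≤ n - k → xstar k I (i, j) ≠ 0 := by
    intro i j hi hik hj hjm
    have h := hxR (k - i) (j - 1) (by omega)
    rw [show k - (k - i) = i by omega, Nat.sub_add_cancel hj] at h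
    rw [h]
    exact div_ne_zero (hne _ _ (by omega) (by omega)) (hne _ _ (by omega) (by omega))
  refine ⟨hxne, ?_, ?_⟩
  · intro i j hi hik hj hjm
    have h := hasDerivAt_gc k (n - k) (xstar k I) hxne i j hi hik hj hjm
    rwa [hbal i j hi hik hj hjm, zero_div] at h
  · have hzero : ∀ φ : ℕ → ℕ → ℂ, ∑ i ∈ Finset.Icc 1 k, ∑ j ∈ Finset.Icc 1 (n - k), φ i j * balB k (n - k) (xstar k I) i j = 0 := by
      intro φ
      refine Finset.sum_eq_zero fun i hi => Finset.sum_eq_zero fun j hj => ?_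
      rw [Finset.mem_Icc] at hi hj
      rw [hbal i j hi.1 hi.2 hj.1 hj.2, mul_zero]
    have s1 := hzero (fun _ _ => 1)
    have s2 := hzero (fun i j => (k : ℂ) - i + j)
    rw [sum_by_parts k (n - k) hk1 (by omega)] at s1 s2
    have q1 : ∀ i j : ℕ, ((k : ℂ) - i + j - ((k : ℂ) - ((i + 1 : ℕ) : ℂ) + j)) = 1 := by
      intro i j; push_cast; ring
    have q2 : ∀ i j : ℕ, ((k : ℂ) - i + ((j + 1 : ℕ) : ℂ) - ((k : ℂ) - i + j)) = 1 := by
      intro i j; push_cast; ring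
    simp only [q1, q2, one_mul] at s2
    simp only [sub_self, zero_mul, Finset.sum_const_zero, one_mul] at s1
    have hnk : ((n - k : ℕ) : ℂ) = n - k := by
      rw [Nat.cast_sub (by omega)]
    rw [hnk] at s2
    push_cast at s2
    have hxk : xstar k I (k, 1) = ∑ z ∈ I, z := by
      have h := hxR 0 0 hk1
      simp only [Nat.sub_zero, zero_add] at h
      rw [h, h0, div_one]
      change schur k (rectPart 1 1) x = _
      rw [schur_one k hk1, hx, Equiv.sum_comp I.equivFin.symm (fun z => (z : ℂ)), Finset.sum_coe_sort I (fun z => z)]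
    unfold gcPotential
    rw [← hxk]
    linear_combination s2 - n * s1

end
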